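/- arXiv:2406.15881 — 3 statements merged into one kernel-verified Lean document; each statement's English description precedes it below -/
import Mathlib

section
/- Let K be a finite tree with |V(K)| ≥ 6 vertices. Then there exist a vertex p ∈ V(K) and vertex subsets A, B ⊆ V(K) such that: (1) A ∪ B = V(K); (2) A ∩ B = {p}; (3) the induced subgraphs K[A] and K[B] are connected (hence subtrees of K); (4) every edge of K has both endpoints in A or both endpoints in B; and (5) |A| ≥ |V(K)|/4 and |B| ≥ |V(K)|/4. -/
/-- A set of vertices containing `p` that the edges of `G` leave only through `p`. -/
structure SimpleGraph.IsBranch {V : Type*} (G : SimpleGraph V) (p : V) (S : Finset V) : Prop where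
  pivot_mem : p ∈ S
  mem_of_adj : ∀ ⦃u v⦄, u ∈ S → u ≠ p → G.Adj u v → v ∈ S

namespace SimpleGraph.IsBranch

variable {V : Type*} {G : SimpleGraph V} {p : V} {S T : Finset V}

lemma connected_induce (hS : G.IsBranch p S) (hG : G.Preconnected) :
    (G.induce (S : Set V)).Connected := by
  have key : ∀ {u w : V} (_ : G.Walk u w) (hw : w = p) (hu : u ∈ S),
      (G.induce (S : Set V)).Reachable ⟨u, hu⟩ ⟨p, hS.pivot_mem⟩ := by
    intro u w W
    induction W with
    | nil => rintro rfl _; rfl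
    | @cons u v w h _ ih =>
      intro hw hu
      by_cases hup : u = p
      · subst hup; rfl
      · have hadj : (G.induce (S : Set V)).Adj ⟨u, hu⟩ ⟨v, hS.mem_of_adj hu hup h⟩ := h
        exact hadj.reachable.trans (ih hw _)
  rw [connected_iff_exists_forall_reachable]
  refine ⟨⟨p, hS.pivot_mem⟩, fun ⟨v, hv⟩ => ?_⟩
  obtain ⟨W⟩ := hG v p
  exact (key W rfl hv).symm

lemma insert_sdiff [DecidableEq V] (hS : G.IsBranch p S) (hT : G.IsBranch p T) :
    G.IsBranch p (insert p (T \ S)) := by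
  refine ⟨Finset.mem_insert_self _ _, fun u v hu hup huv => ?_⟩
  simp only [Finset.mem_insert, Finset.mem_sdiff, hup, false_or] at hu ⊢
  by_cases hvp : v = p
  · exact Or.inl hvp
  · exact Or.inr ⟨hT.mem_of_adj hu.1 hup huv, fun hv => hu.2 (hS.mem_of_adj hv hvp huv.symm)⟩

/-- In a tree, a branch with at least two vertices strictly contains a branch with at least half
as many vertices. -/
lemma exists_ssubset_card_le_two_mul [DecidableEq V] (hG : G.IsTree) (hS : G.IsBranch p S)
    (hcard : 2 ≤ S.card) : ∃ q, ∃ T ⊂ S, G.IsBranch q T ∧ S.card ≤ 2 * T.card := by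
  classical
  obtain ⟨a, haS, hap⟩ := Finset.exists_mem_ne hcard p
  obtain ⟨q, hqS, hqp⟩ : ∃ q ∈ S, G.Adj p q := by
    obtain ⟨W⟩ := hG.connected a p
    obtain ⟨d, -, hd, hd'⟩ := W.exists_boundary_dart {v | v ∈ S ∧ v ≠ p} ⟨haS, hap⟩ (by simp)
    have hdS := hS.mem_of_adj hd.1 hd.2 d.adj
    have hdp : d.snd = p := by
      by_contra h
      exact hd' ⟨hdS, h⟩
    exact ⟨d.fst, hd.1, hdp ▸ d.adj.symm⟩
  let H := G.deleteEdges {s(p, q)}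
  have hbridge : ¬ H.Reachable p q := by
    have := isAcyclic_iff_forall_adj_isBridge.1 hG.isAcyclic hqp
    simpa [isBridge_iff, H] using this
  let T := S.filter (H.Reachable p)
  have hqT : q ∉ T := fun h => hbridge (Finset.mem_filter.1 h).2
  have hTS : T ⊂ S :=
    Finset.ssubset_iff_subset_ne.2 ⟨Finset.filter_subset _ _, fun h => hqT (h ▸ hqS)⟩
  have hT : G.IsBranch p T := by
    refine ⟨Finset.mem_filter.2 ⟨hS.pivot_mem, .refl _⟩, fun u v hu hup huv => ?_⟩
    have huq : u ≠ q := fun h => hqT (h ▸ hu)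
    have hadj : H.Adj u v := by
      simp [H, huv, hup, huq]
    rw [Finset.mem_filter] at hu ⊢
    exact ⟨hS.mem_of_adj hu.1 hup huv, hu.2.trans hadj.reachable⟩
  by_cases hTp : T = {p}
  · refine ⟨q, S.erase p, Finset.erase_ssubset hS.pivot_mem, ⟨?_, fun u v hu huq huv => ?_⟩, ?_⟩
    · exact Finset.mem_erase.2 ⟨hqp.ne', hqS⟩
    · obtain ⟨hup, huS⟩ := Finset.mem_erase.1 hu
      refine Finset.mem_erase.2 ⟨?_, hS.mem_of_adj huS hup huv⟩
      rintro rfl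
      have hadj : H.Adj v u := by
        simp [H, huv.symm, huq, hqp.ne]
      have huT : u ∈ T := Finset.mem_filter.2 ⟨huS, hadj.reachable⟩
      rw [hTp, Finset.mem_singleton] at huT
      exact hup huT
    · rw [Finset.card_erase_of_mem hS.pivot_mem]
      lia
  · have hcompl : (insert p (S \ T)).card = S.card - T.card + 1 := by
      rw [Finset.card_insert_of_notMem (by simp [hT.pivot_mem]), Finset.card_sdiff_of_subset hTS.1]
    have hTcard := Finset.card_lt_card hTS
    by_cases hle : S.card ≤ 2 * T.card
    · exact ⟨p, T, hTS, hT, hle⟩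
    · refine ⟨p, insert p (S \ T), ?_, hT.insert_sdiff hS, by lia⟩
      obtain ⟨t, htT, htp⟩ : ∃ t ∈ T, t ≠ p := by
        by_contra! h
        exact hTp (Finset.eq_singleton_iff_unique_mem.2 ⟨hT.pivot_mem, h⟩)
      refine (Finset.ssubset_iff_of_subset ?_).2 ⟨t, hTS.1 htT, by simp [htp, htT]⟩
      exact Finset.insert_subset hS.pivot_mem Finset.sdiff_subset

/-- Shrinking a branch of a tree yields one of size at least `n / 4` and at most
`3 * n / 4 + 1`. -/
lemma exists_card_between [DecidableEq V] (hG : G.IsTree) {n : ℕ} (hS : G.IsBranch p S)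
    (hn : n ≤ 4 * S.card) :
    ∃ q T, G.IsBranch q T ∧ n ≤ 4 * T.card ∧ 4 * T.card ≤ 3 * n + 4 := by
  induction S using Finset.strongInduction generalizing p with
  | H S ih =>
    by_cases hle : 4 * S.card ≤ 3 * n + 4
    · exact ⟨p, S, hS, hn, hle⟩
    · obtain ⟨q, T, hTS, hT, hcard⟩ := hS.exists_ssubset_card_le_two_mul hG (by lia)
      exact ih T hTS hT (by lia)

end SimpleGraph.IsBranch

/-- Pivoting Lemma: Every finite tree `K` with at least 6 vertices admits
a decomposition into two subtrees `K[A]`, `K[B]` overlapping exactly in a pivot vertex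
`p`, covering all vertices and all edges, with each part of size at least `|V(K)|/4`. -/
theorem tree_pivot_decomposition {V : Type*} [Fintype V] [DecidableEq V]
    (K : SimpleGraph V) (hK : K.IsTree) (hcard : 6 ≤ Fintype.card V) :
    ∃ (p : V) (A B : Finset V),
      A ∪ B = Finset.univ ∧
      A ∩ B = {p} ∧
      (K.induce (A : Set V)).Connected ∧
      (K.induce (B : Set V)).Connected ∧
      (∀ u v : V, K.Adj u v → (u ∈ A ∧ v ∈ A) ∨ (u ∈ B ∧ v ∈ B)) ∧
      (Fintype.card V : ℝ) / 4 ≤ A.card ∧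
      (Fintype.card V : ℝ) / 4 ≤ B.card := by
  obtain ⟨r⟩ := hK.connected.nonempty
  have huniv (q : V) : K.IsBranch q Finset.univ := ⟨Finset.mem_univ _, fun _ _ _ _ _ => by simp⟩
  obtain ⟨p, A, hA, hlow, hup⟩ := (huniv r).exists_card_between hK (n := Fintype.card V)
    (by rw [Finset.card_univ]; lia)
  have hB := hA.insert_sdiff (huniv p)
  have hBcard : (insert p (Finset.univ \ A)).card = Fintype.card V - A.card + 1 := by
    rw [Finset.card_insert_of_notMem (by simp [hA.pivot_mem]),
      Finset.card_sdiff_of_subset (Finset.subset_univ A), Finset.card_univ]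
  have hAle := Finset.card_le_univ A
  have hquarter {m : ℕ} (h : Fintype.card V ≤ 4 * m) : (Fintype.card V : ℝ) / 4 ≤ m := by
    have : (Fintype.card V : ℝ) ≤ 4 * m := mod_cast h
    linarith
  refine ⟨p, A, insert p (Finset.univ \ A), ?_, ?_, hA.connected_induce hK.connected.preconnected,
    hB.connected_induce hK.connected.preconnected, fun u v huv => ?_, hquarter hlow,
    hquarter (by lia)⟩
  · ext v
    simp only [Finset.mem_union, Finset.mem_insert, Finset.mem_sdiff, Finset.mem_univ]
    tauto
  · ext v
    have := hA.pivot_mem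
    simp only [Finset.mem_inter, Finset.mem_insert, Finset.mem_sdiff, Finset.mem_univ,
      Finset.mem_singleton]
    grind
  · have hAuv := @hA.mem_of_adj u v
    have hAvu := @hA.mem_of_adj v u
    have := hA.pivot_mem
    have := huv.symm
    simp only [Finset.mem_insert, Finset.mem_sdiff, Finset.mem_univ, true_and]
    grind
end

section
/- Let λ ∈ ℝ, let p : ℝ → ℝ be a polynomial of degree at most B, and set f(x) = exp(λx)·p(x). Then for any real numbers x_1, …, x_a and y_1, …, y_b, the matrix M ∈ ℝ^{a×b} with entries M(i,j) = f(x_i + y_j) can be written as a sum of at most B + 1 outer-product matrices; in particular, M has rank at most B + 1. -/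
/-- The rank of a sum of `k` outer products is at most `k`. -/
theorem Matrix.rank_sum_vecMulVec_le {R : Type*} [Field R] {m n k : ℕ}
    (u : Fin k → Fin m → R) (w : Fin k → Fin n → R) :
    (∑ t, Matrix.vecMulVec (u t) (w t)).rank ≤ k := by
  have h : ∑ t, Matrix.vecMulVec (u t) (w t) = (Matrix.of u).transpose * Matrix.of w := by
    ext i j
    simp [Matrix.sum_apply, Matrix.mul_apply, Matrix.vecMulVec_apply]
  rw [h]
  exact (Matrix.rank_mul_le_right _ _).trans (Matrix.rank_le_height _)

/-- Expansion of `p(x + y)` in powers of `x`, with coefficients depending on `y`. -/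
theorem Polynomial.eval_add_eq_sum_fin {R : Type*} [CommRing R] {p : Polynomial R} {B : ℕ}
    (hp : p.natDegree ≤ B) (x y : R) :
    p.eval (x + y) = ∑ t : Fin (B + 1), x ^ (t : ℕ) * (Polynomial.taylor y p).coeff t := by
  have hdeg : (Polynomial.taylor y p).natDegree < B + 1 := by
    rw [Polynomial.natDegree_taylor]
    omega
  rw [← Polynomial.taylor_eval, Polynomial.eval_eq_sum_range' hdeg, Finset.sum_range]
  exact Finset.sum_congr rfl fun t _ => mul_comm _ _

/-- For `f(x) = exp(λx)·p(x)` with `p` a polynomial of degree at most `B`,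
the matrix `M(i,j) = f(x_i + y_j)` is a sum of at most `B + 1` outer products;
in particular it has rank at most `B + 1`. -/
theorem exp_times_poly_f_matrix_low_rank (lam : ℝ) (B : ℕ) (p : Polynomial ℝ)
    (hp : p.natDegree ≤ B) (f : ℝ → ℝ) (hf : ∀ z : ℝ, f z = Real.exp (lam * z) * p.eval z)
    (a b : ℕ) (x : Fin a → ℝ) (y : Fin b → ℝ) :
    (∃ (uu : Fin (B + 1) → Fin a → ℝ) (ww : Fin (B + 1) → Fin b → ℝ),
      (Matrix.of fun i j => f (x i + y j)) = ∑ t, Matrix.vecMulVec (uu t) (ww t)) ∧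
    (Matrix.of fun i j => f (x i + y j)).rank ≤ B + 1 := by
  have key : ∃ (uu : Fin (B + 1) → Fin a → ℝ) (ww : Fin (B + 1) → Fin b → ℝ),
      (Matrix.of fun i j => f (x i + y j)) = ∑ t, Matrix.vecMulVec (uu t) (ww t) := by
    refine ⟨fun t i => Real.exp (lam * x i) * x i ^ (t : ℕ),
      fun t j => Real.exp (lam * y j) * (Polynomial.taylor (y j) p).coeff t, ?_⟩
    ext i j
    rw [Matrix.of_apply, hf, Polynomial.eval_add_eq_sum_fin hp, mul_add, Real.exp_add,
      Finset.mul_sum, Matrix.sum_apply]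
    refine Finset.sum_congr rfl fun t _ => ?_
    rw [Matrix.vecMulVec_apply]
    ring
  refine ⟨key, ?_⟩
  obtain ⟨u, w, h⟩ := key
  rw [h]
  exact Matrix.rank_sum_vecMulVec_le u w
end

section
/- Let d ∈ ℕ and C > 0, and let T : ℕ → ℝ be nonnegative and nondecreasing. Suppose that for every n ≥ 6 there exist natural numbers a and b with n/4 ≤ a ≤ 3n/4, n/4 ≤ b ≤ 3n/4, a + b = n + 1, and T(n) ≤ T(a) + T(b) + C·n·(log n)^d. Then there exists a constant C' > 0 such that T(n) ≤ C'·n·(log n)^{d+1} for all n ≥ 2. -/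
/-- Shrinking the argument of the logarithm by a factor `3 / 4` decreases `(log n) ^ (d + 1)`
by at least `log (4 / 3) * (log n) ^ d`. -/
theorem log_pow_succ_le_of_le_three_quarters (d : ℕ) {x y : ℝ} (hx : 1 ≤ x)
    (hxy : x ≤ 3 * y / 4) :
    Real.log x ^ (d + 1) ≤ Real.log y ^ d * (Real.log y - Real.log (4 / 3)) := by
  have hx0 : 0 < x := by linarith
  have hlog0 : 0 ≤ Real.log x := Real.log_nonneg hx
  have hle : Real.log x ≤ Real.log y := Real.log_le_log hx0 (by linarith)
  have hsub : Real.log x ≤ Real.log y - Real.log (4 / 3) := by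
    rw [← Real.log_div (by linarith) (by norm_num)]
    exact Real.log_le_log hx0 (by linarith)
  rw [pow_succ]
  have hy : 0 ≤ Real.log y ^ d := pow_nonneg (hlog0.trans hle) d
  gcongr

/-- Divide-and-conquer recurrence. If a nonnegative nondecreasing
`T : ℕ → ℝ` satisfies, for every `n ≥ 6`, `T(n) ≤ T(a) + T(b) + C·n·(log n)^d` for some
`a, b` with `n/4 ≤ a, b ≤ 3n/4` and `a + b = n + 1`, then
`T(n) = O(n·(log n)^{d+1})`. -/
theorem divide_and_conquer_recurrence (d : ℕ) (C : ℝ) (hC : 0 < C)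
    (T : ℕ → ℝ) (hT0 : ∀ n, 0 ≤ T n) (hmono : Monotone T)
    (hrec : ∀ n : ℕ, 6 ≤ n → ∃ a b : ℕ,
      (n : ℝ) / 4 ≤ (a : ℝ) ∧ (a : ℝ) ≤ 3 * (n : ℝ) / 4 ∧
      (n : ℝ) / 4 ≤ (b : ℝ) ∧ (b : ℝ) ≤ 3 * (n : ℝ) / 4 ∧
      a + b = n + 1 ∧
      T n ≤ T a + T b + C * (n : ℝ) * (Real.log n) ^ d) :
    ∃ C' : ℝ, 0 < C' ∧ ∀ n : ℕ, 2 ≤ n → T n ≤ C' * (n : ℝ) * (Real.log n) ^ (d + 1) := by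
  have hδ : 0 < Real.log (4 / 3) := Real.log_pos (by norm_num)
  have hlog2 : 0 < Real.log 2 := Real.log_pos (by norm_num)
  obtain ⟨K, hK, hKC, hKT⟩ : ∃ K : ℝ, 0 < K ∧ 2 * C ≤ K * Real.log (4 / 3) ∧
      T 5 ≤ K * Real.log 2 ^ (d + 1) := by
    have hp : 0 < Real.log 2 ^ (d + 1) := by positivity
    have hC' : 0 < 2 * C / Real.log (4 / 3) := by positivity
    exact ⟨max (2 * C / Real.log (4 / 3)) (T 5 / Real.log 2 ^ (d + 1)),
      lt_max_of_lt_left hC', (div_le_iff₀ hδ).mp (le_max_left _ _),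
      (div_le_iff₀ hp).mp (le_max_right _ _)⟩
  have key : ∀ n : ℕ, 2 ≤ n → T n ≤ K * ((n : ℝ) - 1) * Real.log n ^ (d + 1) := by
    intro n
    induction n using Nat.strong_induction_on with
    | _ n ih =>
      intro hn
      have hnR : (2 : ℝ) ≤ n := by exact_mod_cast hn
      have hlogn : 0 ≤ Real.log n := Real.log_nonneg (by linarith)
      rcases Nat.lt_or_ge n 6 with hn6 | hn6
      · calc T n ≤ T 5 := hmono (by omega)
          _ ≤ K * 1 * Real.log 2 ^ (d + 1) := by rwa [mul_one]
          _ ≤ K * ((n : ℝ) - 1) * Real.log n ^ (d + 1) := by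
            have hK' : 0 ≤ K * ((n : ℝ) - 1) := mul_nonneg hK.le (by linarith)
            gcongr
            linarith
      · have step : ∀ a : ℕ, (n : ℝ) / 4 ≤ a → (a : ℝ) ≤ 3 * n / 4 →
            T a ≤ K * ((a : ℝ) - 1) *
              (Real.log n ^ d * (Real.log n - Real.log (4 / 3))) := by
          intro a ha ha'
          have hn6R : (6 : ℝ) ≤ n := by exact_mod_cast hn6
          have ha1 : 1 < a := by
            have : (1 : ℝ) < a := by linarith
            exact_mod_cast this
          have han : a < n := by
            have : (a : ℝ) < n := by linarith
            exact_mod_cast this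
          have ha1R : (1 : ℝ) ≤ a := by linarith
          exact (ih a han ha1).trans <| mul_le_mul_of_nonneg_left
            (log_pow_succ_le_of_le_three_quarters d ha1R ha')
            (mul_nonneg hK.le (by linarith))
        obtain ⟨a, b, ha, ha', hb, hb', hab, hT⟩ := hrec n hn6
        have habR : (b : ℝ) = n + 1 - a := by
          have : (a : ℝ) + b = n + 1 := by exact_mod_cast hab
          linarith
        have hTa := step a ha ha'
        have hTb := step b hb hb'
        have hcost : C * n ≤ K * Real.log (4 / 3) * ((n : ℝ) - 1) := by
          nlinarith
        have hcost' := mul_le_mul_of_nonneg_right hcost (pow_nonneg hlogn d)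
        calc T n ≤ _ := hT
          _ ≤ K * ((a : ℝ) - 1) * (Real.log n ^ d * (Real.log n - Real.log (4 / 3))) +
              K * ((n : ℝ) + 1 - a - 1) *
                (Real.log n ^ d * (Real.log n - Real.log (4 / 3))) +
              K * Real.log (4 / 3) * ((n : ℝ) - 1) * Real.log n ^ d := by
            rw [← habR]
            exact add_le_add (add_le_add hTa hTb) hcost'
          _ = K * ((n : ℝ) - 1) * Real.log n ^ (d + 1) := by ring
  refine ⟨K, hK, fun n hn => (key n hn).trans ?_⟩
  have hnR : (2 : ℝ) ≤ n := by exact_mod_cast hn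
  have hlogn : 0 ≤ Real.log n := Real.log_nonneg (by linarith)
  gcongr
  linarith
end
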